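/- (Proposition 1) The function (α,d) ↦ ln f_0*(α,d) is strictly biconcave on its domain: for each fixed d ∈ (0, min(φ_max, ψ_max)), the map α ↦ ln f_0*(α,d) is strictly concave on {α ∈ (0, 1 − d/φ_max) : ψ_α⁻¹(d) < s_in}, and for each fixed α ∈ (0,1), the map d ↦ ln f_0*(α,d) is strictly concave on {d ∈ (0, min((1−α)·φ_max, ψ_max)) : ψ_α⁻¹(d) < s_in}, where f_0*(α,d) = d·(α·β·γ·(s_in − φ⁻¹(d/(1−α))) − ψ⁻¹(d))/μ⁻¹(d) is strictly positive on these sets. -/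

import Mathlib

/-- The inverse of the Monod function `φ` on `[0, φmax)`: `φ⁻¹(y) = ks·y/(φmax−y)`. -/
noncomputable def phiInv (phimax ks y : ℝ) : ℝ := ks * y / (phimax - y)

/-- The inverse of `μ` on `[0, μmax)`: `μ⁻¹(y) = qmin·μmax/(μmax − y)`. -/
noncomputable def muInv (mumax qmin y : ℝ) : ℝ := qmin * mumax / (mumax - y)

/-- `ψmax = μmax·ρmax/(ρmax + qmin·μmax)`. -/
noncomputable def psiMax (rhomax mumax qmin : ℝ) : ℝ :=
  mumax * rhomax / (rhomax + qmin * mumax)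

/-- `k_c = kv·qmin·μmax/(ρmax + qmin·μmax)`. -/
noncomputable def kC (rhomax kv mumax qmin : ℝ) : ℝ :=
  kv * qmin * mumax / (rhomax + qmin * mumax)

/-- The inverse of `ψ` on `[0, ψmax)`: `ψ⁻¹(y) = k_c·y/(ψmax − y)`. -/
noncomputable def psiInv (rhomax kv mumax qmin y : ℝ) : ℝ :=
  kC rhomax kv mumax qmin * y / (psiMax rhomax mumax qmin - y)

/-- `ψ_α⁻¹(y) = φ⁻¹(y/(1−α)) + ψ⁻¹(y)/(α·β·γ)`. -/
noncomputable def psiAlphaInv (phimax ks rhomax kv mumax qmin beta gamma alpha y : ℝ) : ℝ :=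
  phiInv phimax ks (y / (1 - alpha)) + psiInv rhomax kv mumax qmin y / (alpha * beta * gamma)

/-- The static objective
`f_0*(α,d) = d·(α·β·γ·(s_in − φ⁻¹(d/(1−α))) − ψ⁻¹(d))/μ⁻¹(d)`. -/
noncomputable def f0 (phimax ks rhomax kv mumax qmin beta gamma sIn alpha d : ℝ) : ℝ :=
  d * (alpha * beta * gamma * (sIn - phiInv phimax ks (d / (1 - alpha)))
        - psiInv rhomax kv mumax qmin d) / muInv mumax qmin d

theorem aux_inv {u v a b : ℝ} (hu : 0 < u) (hv : 0 < v) (huv : u ≠ v) (ha : 0 < a) (hb : 0 < b)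
    (hab : a + b = 1) : (a * u + b * v)⁻¹ < a * u⁻¹ + b * v⁻¹ := by
  have h : 0 < a * u + b * v := by positivity
  have hb' : b = 1 - a := by linarith
  have key : a * u⁻¹ + b * v⁻¹ - (a * u + b * v)⁻¹
      = a * b * (u - v) ^ 2 / (u * v * (a * u + b * v)) := by
    have h' : a * u + (1 - a) * v ≠ 0 := by rw [← hb']; exact h.ne'
    subst hb'
    field_simp
    ring
  have h2 : 0 < (u - v) ^ 2 := by
    have : u - v ≠ 0 := sub_ne_zero.mpr huv
    positivity
  have : 0 < a * b * (u - v) ^ 2 / (u * v * (a * u + b * v)) := by positivity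
  linarith

theorem aux_conv (A : ℝ) : StrictConvexOn ℝ (Set.Iio A) (fun x : ℝ => (A - x)⁻¹) := by
  refine ⟨convex_Iio A, ?_⟩
  intro x hx y hy hxy a b ha hb hab
  have h := aux_inv (sub_pos.mpr hx) (sub_pos.mpr hy) (fun h => hxy (by linarith)) ha hb hab
  have e : A - (a * x + b * y) = a * (A - x) + b * (A - y) := by
    have : b = 1 - a := by linarith
    subst this; ring
  simp only [smul_eq_mul]
  rw [e]; exact h

theorem aux_log {s : Set ℝ} {f : ℝ → ℝ} (hf : StrictConcaveOn ℝ s f) (hp : ∀ x ∈ s, 0 < f x) :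
    StrictConcaveOn ℝ s (fun x => Real.log (f x)) := by
  refine ⟨hf.1, ?_⟩
  intro x hx y hy hxy a b ha hb hab
  have h1 := hf.2 hx hy hxy ha hb hab
  have h2 := strictConcaveOn_log_Ioi.concaveOn.2 (hp x hx) (hp y hy) ha.le hb.le hab
  refine lt_of_le_of_lt h2 (Real.log_lt_log ?_ h1)
  have := hp x hx
  have := hp y hy
  simp only [smul_eq_mul]; positivity

theorem aux_log' {s : Set ℝ} {f : ℝ → ℝ} (hf : ConcaveOn ℝ s f) (hp : ∀ x ∈ s, 0 < f x) :
    ConcaveOn ℝ s (fun x => Real.log (f x)) := by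
  refine ⟨hf.1, ?_⟩
  intro x hx y hy a b ha hb hab
  have h1 := hf.2 hx hy ha hb hab
  have h2 := strictConcaveOn_log_Ioi.concaveOn.2 (hp x hx) (hp y hy) ha hb hab
  refine h2.trans (Real.log_le_log ?_ h1)
  exact (convex_Ioi (0:ℝ)) (hp x hx) (hp y hy) ha hb hab

theorem aux_psiMax {r m q : ℝ} (hr : 0 < r) (hm : 0 < m) (hq : 0 < q) :
    0 < psiMax r m q ∧ psiMax r m q < m := by
  unfold psiMax
  refine ⟨by positivity, ?_⟩
  rw [div_lt_iff₀ (by positivity)]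
  have : 0 < m * (q * m) := by positivity
  nlinarith

theorem aux_phi {p k d t : ℝ} (ht : 0 < 1 - t) :
    phiInv p k (d / (1 - t)) = k * d / ((1 - t) * p - d) := by
  unfold phiInv
  have : p - d / (1 - t) = ((1 - t) * p - d) / (1 - t) := by
    field_simp
  rw [this, ← mul_div_assoc, div_div_div_cancel_right₀ ht.ne']

theorem aux_iff {B P Q s : ℝ} (hB : 0 < B) : P + Q / B < s ↔ 0 < B * (s - P) - Q := by
  rw [← lt_sub_iff_add_lt', div_lt_iff₀ hB, sub_pos, mul_comm]

/-- (Proposition 1) `(α,d) ↦ ln f_0*(α,d)` is strictly biconcave on its domain: for each fixed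
`d ∈ (0, min(φmax, ψmax))`, `α ↦ ln f_0*(α,d)` is strictly concave on
`{α ∈ (0, 1 − d/φmax) : ψ_α⁻¹(d) < s_in}`, and for each fixed `α ∈ (0,1)`,
`d ↦ ln f_0*(α,d)` is strictly concave on
`{d ∈ (0, min((1−α)·φmax, ψmax)) : ψ_α⁻¹(d) < s_in}`; moreover `f_0*` is strictly positive
on these sets. -/
theorem f0_strictly_log_biconcave (phimax ks rhomax kv mumax qmin beta gamma sIn : ℝ)
    (hphimax : 0 < phimax) (hks : 0 < ks) (hrho : 0 < rhomax) (hkv : 0 < kv)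
    (hmu : 0 < mumax) (hqmin : 0 < qmin) (hbeta : 0 < beta) (hgamma : 0 < gamma)
    (hsIn : 0 < sIn) :
    (∀ d ∈ Set.Ioo 0 (min phimax (psiMax rhomax mumax qmin)),
      (∀ alpha ∈ {alpha ∈ Set.Ioo (0:ℝ) (1 - d / phimax) |
          psiAlphaInv phimax ks rhomax kv mumax qmin beta gamma alpha d < sIn},
        0 < f0 phimax ks rhomax kv mumax qmin beta gamma sIn alpha d) ∧
      StrictConcaveOn ℝ
        {alpha ∈ Set.Ioo (0:ℝ) (1 - d / phimax) |
          psiAlphaInv phimax ks rhomax kv mumax qmin beta gamma alpha d < sIn}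
        (fun alpha : ℝ =>
          Real.log (f0 phimax ks rhomax kv mumax qmin beta gamma sIn alpha d))) ∧
    (∀ alpha ∈ Set.Ioo (0:ℝ) 1,
      (∀ d ∈ {d ∈ Set.Ioo 0 (min ((1 - alpha) * phimax) (psiMax rhomax mumax qmin)) |
          psiAlphaInv phimax ks rhomax kv mumax qmin beta gamma alpha d < sIn},
        0 < f0 phimax ks rhomax kv mumax qmin beta gamma sIn alpha d) ∧
      StrictConcaveOn ℝ
        {d ∈ Set.Ioo 0 (min ((1 - alpha) * phimax) (psiMax rhomax mumax qmin)) |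
          psiAlphaInv phimax ks rhomax kv mumax qmin beta gamma alpha d < sIn}
        (fun d : ℝ =>
          Real.log (f0 phimax ks rhomax kv mumax qmin beta gamma sIn alpha d))) := by
  obtain ⟨hps, hpm⟩ := aux_psiMax hrho hmu hqmin
  have hkc : 0 < kC rhomax kv mumax qmin := by unfold kC; positivity
  refine ⟨?_, ?_⟩
  · rintro d ⟨hd0, hd⟩
    obtain ⟨hd1, hd2⟩ := lt_min_iff.mp hd
    set g : ℝ → ℝ := fun alpha => alpha * beta * gamma *
      (sIn - phiInv phimax ks (d / (1 - alpha))) - psiInv rhomax kv mumax qmin d with hg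
    have hI : ∀ t ∈ Set.Ioo (0:ℝ) (1 - d / phimax), 0 < 1 - t ∧ t < 1 - d / phimax := by
      intro t ht
      have : 0 < d / phimax := by positivity
      exact ⟨by linarith [ht.2], ht.2⟩
    have hS : {alpha ∈ Set.Ioo (0:ℝ) (1 - d / phimax) |
          psiAlphaInv phimax ks rhomax kv mumax qmin beta gamma alpha d < sIn}
        = {alpha ∈ Set.Ioo (0:ℝ) (1 - d / phimax) | 0 < g alpha} := by
      ext t
      simp only [Set.mem_ofPred_eq]
      refine and_congr_right fun ht => ?_
      have := ht.1
      exact aux_iff (by positivity)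
    have hgc : StrictConcaveOn ℝ (Set.Ioo (0:ℝ) (1 - d / phimax)) g := by
      have h1 := (aux_conv (1 - d / phimax)).subset
        (s := Set.Ioo (0:ℝ) (1 - d / phimax)) (fun x hx => hx.2) (convex_Ioo _ _)
      refine ⟨convex_Ioo _ _, ?_⟩
      have e : ∀ t ∈ Set.Ioo (0:ℝ) (1 - d / phimax), g t = beta * gamma * sIn * t
          - beta * gamma * ks * d / phimax * (1 - d / phimax) * (1 - d / phimax - t)⁻¹
          + beta * gamma * ks * d / phimax - psiInv rhomax kv mumax qmin d := by
        intro t ht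
        obtain ⟨a1, a2⟩ := hI t ht
        have a3 : 0 < 1 - d / phimax - t := by linarith
        have a4 : (1 - t) * phimax - d = phimax * (1 - d / phimax - t) := by
          field_simp
          ring
        simp only [hg]
        rw [aux_phi a1, a4]
        generalize hw : 1 - d / phimax - t = w at *
        have a5 : 1 - d / phimax = w + t := by linarith
        rw [a5]
        field_simp
        ring
      intro x hx y hy hxy a b ha hb hab
      have hz := convex_Ioo (0:ℝ) (1 - d / phimax) hx hy ha.le hb.le hab
      have h2 := h1.2 hx hy hxy ha hb hab
      rw [e x hx, e y hy, e _ hz]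
      simp only [smul_eq_mul] at h2 ⊢
      have hpos : 0 < 1 - d / phimax := by linarith [hx.1, hx.2]
      have hC : 0 < beta * gamma * ks * d / phimax * (1 - d / phimax) := by positivity
      have h3 := mul_lt_mul_of_pos_left h2 hC
      have hb' : b = 1 - a := by linarith
      subst hb'
      linarith
    have hmi : 0 < d / muInv mumax qmin d := by
      unfold muInv
      have : 0 < mumax - d := by linarith
      positivity
    have hf : ∀ t, f0 phimax ks rhomax kv mumax qmin beta gamma sIn t d
        = d / muInv mumax qmin d * g t := by
      intro t
      simp only [f0, hg]
      ring
    rw [hS]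
    refine ⟨fun t ht => ?_, ?_⟩
    · rw [hf]; exact mul_pos hmi ht.2
    · simp only [hf]
      have hcs := hgc.subset (s := {alpha ∈ Set.Ioo (0:ℝ) (1 - d / phimax) | 0 < g alpha})
        (fun x hx => hx.1) (hgc.concaveOn.convex_gt 0)
      refine aux_log ⟨hcs.1, ?_⟩ (fun t ht => mul_pos hmi ht.2)
      intro x hx y hy hxy a b ha hb hab
      have h3 := mul_lt_mul_of_pos_left (hcs.2 hx hy hxy ha hb hab) hmi
      simp only [smul_eq_mul] at h3 ⊢
      linarith
  · rintro alpha ⟨ha0, ha1⟩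
    have ha1' : 0 < 1 - alpha := by linarith
    set I := Set.Ioo 0 (min ((1 - alpha) * phimax) (psiMax rhomax mumax qmin)) with hIdef
    set h : ℝ → ℝ := fun d => alpha * beta * gamma *
      (sIn - phiInv phimax ks (d / (1 - alpha))) - psiInv rhomax kv mumax qmin d with hh
    have hB : 0 < alpha * beta * gamma := by positivity
    have hS : {d ∈ I | psiAlphaInv phimax ks rhomax kv mumax qmin beta gamma alpha d < sIn}
        = {d ∈ I | 0 < h d} := by
      ext t
      simp only [Set.mem_ofPred_eq]
      exact and_congr_right fun ht => aux_iff hB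
    have hI1 : I ⊆ Set.Iio ((1 - alpha) * phimax) := fun x hx => (lt_min_iff.mp hx.2).1
    have hI2 : I ⊆ Set.Iio (psiMax rhomax mumax qmin) := fun x hx => (lt_min_iff.mp hx.2).2
    have hIc : Convex ℝ I := convex_Ioo _ _
    have hhc : ConcaveOn ℝ I h := by
      have h1 := ((aux_conv ((1 - alpha) * phimax)).subset hI1 hIc).convexOn
      have h2 := ((aux_conv (psiMax rhomax mumax qmin)).subset hI2 hIc).convexOn
      have e : ∀ t ∈ I, h t = alpha * beta * gamma * (sIn + ks) + kC rhomax kv mumax qmin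
          - alpha * beta * gamma * ks * ((1 - alpha) * phimax)
            * ((1 - alpha) * phimax - t)⁻¹
          - kC rhomax kv mumax qmin * psiMax rhomax mumax qmin
            * (psiMax rhomax mumax qmin - t)⁻¹ := by
        intro t ht
        have b1 : 0 < (1 - alpha) * phimax - t := sub_pos.mpr (hI1 ht)
        have b2 : 0 < psiMax rhomax mumax qmin - t := sub_pos.mpr (hI2 ht)
        simp only [hh, psiInv]
        rw [aux_phi ha1']
        generalize (1 - alpha) * phimax = A at *
        generalize psiMax rhomax mumax qmin = P at *
        field_simp
        ring
      refine ⟨hIc, ?_⟩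
      intro x hx y hy a b ha hb hab
      have hz := hIc hx hy ha hb hab
      have h3 := h1.2 hx hy ha hb hab
      have h4 := h2.2 hx hy ha hb hab
      rw [e x hx, e y hy, e _ hz]
      simp only [smul_eq_mul] at h3 h4 ⊢
      have hC : 0 ≤ alpha * beta * gamma * ks * ((1 - alpha) * phimax) := by positivity
      have hD : 0 ≤ kC rhomax kv mumax qmin * psiMax rhomax mumax qmin := by positivity
      have h5 := mul_le_mul_of_nonneg_left h3 hC
      have h6 := mul_le_mul_of_nonneg_left h4 hD
      have hb' : b = 1 - a := by linarith
      subst hb'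
      linarith
    have hf : ∀ d, f0 phimax ks rhomax kv mumax qmin beta gamma sIn alpha d
        = d * h d * ((mumax - d) / (qmin * mumax)) := by
      intro d
      simp only [f0, hh, muInv]
      rw [div_div_eq_mul_div, mul_div_assoc]
    rw [hS]
    have hTc : Convex ℝ {d ∈ I | 0 < h d} := hhc.convex_gt 0
    have hmd : ∀ t ∈ {d ∈ I | 0 < h d}, 0 < mumax - t := by
      intro t ht
      have : t < psiMax rhomax mumax qmin := hI2 ht.1
      linarith
    have hq : ∀ t ∈ {d ∈ I | 0 < h d}, 0 < (mumax - t) / (qmin * mumax) := by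
      intro t ht
      have := hmd t ht
      positivity
    refine ⟨fun t ht => ?_, ?_⟩
    · rw [hf]; exact mul_pos (mul_pos ht.1.1 ht.2) (hq t ht)
    · have c1 : StrictConcaveOn ℝ {d ∈ I | 0 < h d} Real.log :=
        strictConcaveOn_log_Ioi.subset (fun x hx => hx.1.1) hTc
      have c2 : ConcaveOn ℝ {d ∈ I | 0 < h d} (fun x => Real.log (h x)) :=
        aux_log' (hhc.subset (fun x hx => hx.1) hTc) (fun x hx => hx.2)
      have c3 : ConcaveOn ℝ {d ∈ I | 0 < h d}
          (fun x => Real.log ((mumax - x) / (qmin * mumax))) := by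
        refine aux_log' ⟨hTc, ?_⟩ hq
        intro x hx y hy a b ha hb hab
        have hb' : b = 1 - a := by linarith
        subst hb'
        simp only [smul_eq_mul]
        apply le_of_eq
        ring
      refine ((c1.add_concaveOn c2).add_concaveOn c3).congr ?_
      intro t ht
      simp only [hf, Pi.add_apply]
      rw [Real.log_mul (mul_pos ht.1.1 ht.2).ne' (hq t ht).ne',
        Real.log_mul (ne_of_gt ht.1.1) ht.2.ne']
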